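/- For every 0 ≤ k ≤ n−1 and ℓ ∈ {1,…,d}, the partial derivatives of the distortion D̃_{k+1}^ℓ with respect to the grid points are ∂D̃_{k+1}^ℓ(Γ_{k+1}^ℓ)/∂x_{k+1}^{ℓ,j_ℓ} = 2 E[ Ψ'_{j_ℓ}(X̂_k) ] (the factor 2 coming from the paper's normalization of the gradient) where, for x ∈ R^d with ϑ_k^ℓ(x) > 0, Ψ'_{j_ℓ}(x) = ( x_{k+1}^{ℓ,j_ℓ} − m_k^ℓ(x) ) ( Φ_0(x_{k+1}^{ℓ,j_ℓ+}(x)) − Φ_0(x_{k+1}^{ℓ,j_ℓ−}(x)) ) + ϑ_k^ℓ(x) ( Φ_0'(x_{k+1}^{ℓ,j_ℓ+}(x)) − Φ_0'(x_{k+1}^{ℓ,j_ℓ−}(x)) ); equivalently, the j_ℓ-th component of the gradient of Γ ↦ Σ_{i∈I_k} E[dist(E_k^ℓ(x_k^i,Z),Γ)^2] P(X̂_k = x_k^i) equals 2 Σ_{i∈I_k} Ψ'_{j_ℓ}(x_k^i) P(X̂_k = x_k^i). -/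

import Mathlib

open MeasureTheory ProbabilityTheory Real Set
open scoped ENNReal NNReal Classical

noncomputable section

namespace MPQ

/-- Standard normal cumulative distribution function `Φ₀`. -/
def Phi0 (x : ℝ) : ℝ := ((gaussianReal 0 1) (Set.Iic x)).toReal

/-- `Φ₀` extended to `EReal`, with `Φ₀(−∞) = 0` and `Φ₀(+∞) = 1`. -/
def Phi0E (x : EReal) : ℝ := if x = ⊥ then 0 else if x = ⊤ then 1 else Phi0 x.toReal

/-- Standard normal density `Φ₀'` extended to `EReal`, vanishing at `±∞`. -/
def phi0E (x : EReal) : ℝ := if x = ⊥ ∨ x = ⊤ then 0 else gaussianPDFReal 0 1 x.toReal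

/-- `a ↦ a·Φ₀'(a)` extended to `EReal`, with the convention that it vanishes at `±∞`. -/
def idphi0E (x : EReal) : ℝ :=
  if x = ⊥ ∨ x = ⊤ then 0 else x.toReal * gaussianPDFReal 0 1 x.toReal

/-- The affine renormalisation `c ↦ (c − m)/v` on `EReal` (taking the sign of `v` into
account at `±∞`). -/
def affE (c : EReal) (m v : ℝ) : EReal :=
  if c = ⊤ then (if v < 0 then ⊥ else ⊤)
  else if c = ⊥ then (if v < 0 then ⊤ else ⊥)
  else (((c.toReal - m) / v : ℝ) : EReal)

/-- Lower half-point `x^{j−1/2}` of the `j`-th Voronoi cell (0-based indexing) of the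
grid `g`, with `x^{-1/2} = −∞`. -/
def lo (g : ℕ → ℝ) (j : ℕ) : EReal :=
  if j = 0 then ⊥ else (((g (j - 1) + g j) / 2 : ℝ) : EReal)

/-- Upper half-point `x^{j+1/2}` of the `j`-th Voronoi cell (0-based indexing) of a grid
`g` of size `m`, with the last one equal to `+∞`. -/
def hi (m : ℕ) (g : ℕ → ℝ) (j : ℕ) : EReal :=
  if j + 1 = m then ⊤ else (((g j + g (j + 1)) / 2 : ℝ) : EReal)

/-- The `j`-th Voronoi cell of a (sorted) grid `g` of size `m`. -/
def cell (m : ℕ) (g : ℕ → ℝ) (j : ℕ) : Set ℝ :=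
  {y : ℝ | lo g j < (y : EReal) ∧ (y : EReal) < hi m g j}

/-- Distance from `ξ` to a grid `g` of size `m`. -/
def distToGrid (m : ℕ) (g : ℕ → ℝ) (ξ : ℝ) : ℝ :=
  sInf ((fun j => |ξ - g j|) '' {j | j < m})

/-- Euclidean norm on `Fin d → ℝ`. -/
def enorm2 {d : ℕ} (x : Fin d → ℝ) : ℝ := Real.sqrt (∑ ℓ, (x ℓ) ^ 2)

/-- Frobenius norm of a `d × q` matrix. -/
def fnorm {d q : ℕ} (a : Fin d → Fin q → ℝ) : ℝ := Real.sqrt (∑ ℓ, ∑ p, (a ℓ p) ^ 2)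

/-- The standard Gaussian distribution `N(0; I_m)` on `ℝ^m`. -/
def gaussPi (m : ℕ) : Measure (Fin m → ℝ) := Measure.pi fun _ => gaussianReal 0 1

/-- The probability of an event, as a real number. -/
def pr {Ω : Type*} [MeasureSpace Ω] (A : Set Ω) : ℝ := (ℙ A).toReal

/-- The conditional probability `P(A | B) = P(A ∩ B)/P(B)`. -/
def condPr {Ω : Type*} [MeasureSpace Ω] (A B : Set Ω) : ℝ := pr (A ∩ B) / pr B

end MPQ

open MPQ

open scoped Topology

/-! ### Distance to a grid -/

lemma distToGrid_le {m : ℕ} (g : ℕ → ℝ) (ξ : ℝ) {j : ℕ} (hj : j < m) :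
    distToGrid m g ξ ≤ |ξ - g j| :=
  csInf_le ⟨0, by rintro _ ⟨i, -, rfl⟩; exact abs_nonneg _⟩ ⟨j, hj, rfl⟩

lemma exists_distToGrid_eq {m : ℕ} (hm : 0 < m) (g : ℕ → ℝ) (ξ : ℝ) :
    ∃ j < m, distToGrid m g ξ = |ξ - g j| := by
  have hne : ((fun j => |ξ - g j|) '' {j | j < m}).Nonempty := ⟨_, 0, hm, rfl⟩
  obtain ⟨j, hj, h⟩ := hne.csInf_mem ((Set.finite_lt_nat m).image _)
  exact ⟨j, hj, h.symm⟩

lemma distToGrid_nonneg (m : ℕ) (g : ℕ → ℝ) (ξ : ℝ) : 0 ≤ distToGrid m g ξ :=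
  Real.sInf_nonneg (by rintro _ ⟨i, -, rfl⟩; exact abs_nonneg _)

lemma distToGrid_eq_of_forall_le {m : ℕ} {g : ℕ → ℝ} {ξ : ℝ} {j : ℕ} (hj : j < m)
    (h : ∀ i < m, |ξ - g j| ≤ |ξ - g i|) : distToGrid m g ξ = |ξ - g j| := by
  refine le_antisymm (distToGrid_le g ξ hj) ?_
  obtain ⟨i, hi, hi'⟩ := exists_distToGrid_eq (Nat.zero_lt_of_lt hj) g ξ
  exact hi' ▸ h i hi

lemma continuous_distToGrid {m : ℕ} (hm : 0 < m) (g : ℕ → ℝ) : Continuous (distToGrid m g) := by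
  refine (LipschitzWith.of_le_add fun x y => ?_).continuous
  obtain ⟨j, hj, hy⟩ := exists_distToGrid_eq hm g y
  rw [hy, Real.dist_eq]
  have := abs_sub_le x y (g j)
  linarith [distToGrid_le g x hj]

lemma distToGrid_update_le_add {m : ℕ} (hm : 0 < m) (g : ℕ → ℝ) (ξ : ℝ) (j : ℕ) (s t : ℝ) :
    distToGrid m (Function.update g j t) ξ ≤
      distToGrid m (Function.update g j s) ξ + |s - t| := by
  obtain ⟨i, hi, h⟩ := exists_distToGrid_eq hm (Function.update g j s) ξ
  have hle := distToGrid_le (Function.update g j t) ξ hi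
  rw [h]
  by_cases hij : i = j
  · subst hij
    simp only [Function.update_self] at *
    linarith [abs_sub_le ξ s t]
  · simp only [Function.update_of_ne hij] at *
    linarith [abs_nonneg (s - t)]

lemma distToGrid_update_le {m : ℕ} {g : ℕ → ℝ} {ξ : ℝ} {i j : ℕ} (hi : i < m) (hij : i ≠ j)
    {s : ℝ} (t : ℝ) (hs : |ξ - g i| < |ξ - s|) :
    distToGrid m (Function.update g j t) ξ ≤ distToGrid m (Function.update g j s) ξ := by
  obtain ⟨a, ha, h⟩ := exists_distToGrid_eq (Nat.zero_lt_of_lt hi) (Function.update g j s) ξ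
  by_cases haj : a = j
  · subst haj
    have := distToGrid_le (Function.update g a s) ξ hi
    simp only [h, Function.update_self, Function.update_of_ne hij] at this
    linarith
  · rw [h, Function.update_of_ne haj]
    simpa [Function.update_of_ne haj] using distToGrid_le (Function.update g j t) ξ ha

lemma hasDerivAt_distToGrid_sq_of_nearest {m : ℕ} {g : ℕ → ℝ} {ξ : ℝ} {j : ℕ} (hj : j < m)
    (h : ∀ i < m, i ≠ j → |ξ - g j| < |ξ - g i|) :
    HasDerivAt (fun t => distToGrid m (Function.update g j t) ξ ^ 2) (2 * (g j - ξ)) (g j) := by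
  have hev : ∀ᶠ t in 𝓝 (g j), ∀ i ∈ {i | i < m}, i ≠ j → |ξ - t| < |ξ - g i| := by
    rw [Filter.eventually_all_finite (Set.finite_lt_nat m)]
    intro i hi
    by_cases hij : i = j
    · simp [hij]
    · have hc : ContinuousAt (fun t => |ξ - t|) (g j) := by fun_prop
      filter_upwards [hc.eventually_lt_const (h i hi hij)] with t ht _ using ht
  have hd : HasDerivAt (fun t => (t - ξ) ^ 2) (2 * (g j - ξ)) (g j) := by
    simpa using ((hasDerivAt_id (g j)).sub_const ξ).fun_pow 2
  refine hd.congr_of_eventuallyEq ?_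
  filter_upwards [hev] with t ht
  rw [distToGrid_eq_of_forall_le hj, Function.update_self, sq_abs]
  · ring
  · intro i hi
    by_cases hij : i = j
    · simp [hij]
    · simpa [Function.update_of_ne hij] using (ht i hi hij).le

lemma hasDerivAt_distToGrid_sq_of_lt {m : ℕ} {g : ℕ → ℝ} {ξ : ℝ} {i j : ℕ} (hi : i < m)
    (hij : i ≠ j) (h : |ξ - g i| < |ξ - g j|) :
    HasDerivAt (fun t => distToGrid m (Function.update g j t) ξ ^ 2) 0 (g j) := by
  have hc : ContinuousAt (fun t => |ξ - t|) (g j) := by fun_prop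
  refine (hasDerivAt_const (g j)
    (distToGrid m (Function.update g j (g j)) ξ ^ 2)).congr_of_eventuallyEq ?_
  filter_upwards [hc.eventually_const_lt h] with t ht
  rw [le_antisymm (distToGrid_update_le hi hij t h) (distToGrid_update_le hi hij (g j) ht)]

lemma abs_sub_lt_abs_sub_of_lt_half {ξ a c : ℝ} (hac : a < c) (h : ξ < (a + c) / 2) :
    |ξ - a| < |ξ - c| := by
  rw [← sq_lt_sq]; nlinarith

lemma abs_sub_lt_abs_sub_of_half_lt {ξ a c : ℝ} (hac : a < c) (h : (a + c) / 2 < ξ) :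
    |ξ - c| < |ξ - a| := by
  rw [← sq_lt_sq]; nlinarith

lemma lo_lt_hi {m : ℕ} {g : ℕ → ℝ} (hg : StrictMonoOn g {j | j < m}) {j : ℕ} (hj : j < m) :
    lo g j < hi m g j := by
  unfold lo hi
  split_ifs with h0 h1 h1
  · exact bot_lt_top
  · exact EReal.bot_lt_coe _
  · exact EReal.coe_lt_top _
  · have h2 : g (j - 1) < g j := hg (show j - 1 < m by omega) hj (by omega)
    have h3 : g j < g (j + 1) := hg hj (show j + 1 < m by omega) (by omega)
    exact_mod_cast (by linarith : (g (j - 1) + g j) / 2 < (g j + g (j + 1)) / 2)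

/-- Away from the boundary of the `j`-th Voronoi cell, the squared distance to the grid is
differentiable in the `j`-th grid point. -/
lemma hasDerivAt_distToGrid_sq {m : ℕ} {g : ℕ → ℝ} (hg : StrictMonoOn g {j | j < m})
    {j : ℕ} (hj : j < m) {ξ : ℝ} (hlo : (ξ : EReal) ≠ lo g j) (hhi : (ξ : EReal) ≠ hi m g j) :
    HasDerivAt (fun t => distToGrid m (Function.update g j t) ξ ^ 2)
      (2 * ((if (ξ : EReal) ≤ hi m g j then g j - ξ else 0)
        - (if (ξ : EReal) ≤ lo g j then g j - ξ else 0))) (g j) := by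
  have hlt := lo_lt_hi hg hj
  by_cases h1 : (ξ : EReal) ≤ lo g j
  · rw [if_pos h1, if_pos (h1.trans hlt.le), sub_self, mul_zero]
    replace h1 := lt_of_le_of_ne h1 hlo
    by_cases h0 : j = 0
    · simp [lo, h0] at h1
    · rw [lo, if_neg h0] at h1
      have h2 : g (j - 1) < g j := hg (show j - 1 < m by omega) hj (by omega)
      exact hasDerivAt_distToGrid_sq_of_lt (i := j - 1) (by omega) (by omega)
        (abs_sub_lt_abs_sub_of_lt_half h2 (by exact_mod_cast h1))
  rw [if_neg h1, sub_zero]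
  push Not at h1
  by_cases h2 : (ξ : EReal) ≤ hi m g j
  · rw [if_pos h2]
    replace h2 := lt_of_le_of_ne h2 hhi
    refine hasDerivAt_distToGrid_sq_of_nearest hj fun i hi' hij => ?_
    rcases lt_or_gt_of_ne hij with h | h
    · rw [lo, if_neg (by omega)] at h1
      have h1' : (g (j - 1) + g j) / 2 < ξ := by exact_mod_cast h1
      have h3 : g i ≤ g (j - 1) := hg.monotoneOn hi' (show j - 1 < m by omega) (by omega)
      exact abs_sub_lt_abs_sub_of_half_lt (hg hi' hj h) (by linarith)
    · rw [hi, if_neg (by omega)] at h2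
      have h2' : ξ < (g j + g (j + 1)) / 2 := by exact_mod_cast h2
      have h3 : g (j + 1) ≤ g i := hg.monotoneOn (show j + 1 < m by omega) hi' (by omega)
      exact abs_sub_lt_abs_sub_of_lt_half (hg hj hi' h) (by linarith)
  · rw [if_neg h2, mul_zero]
    push Not at h2
    by_cases h0 : j + 1 = m
    · simp [hi, h0] at h2
    · rw [hi, if_neg h0] at h2
      have h3 : g j < g (j + 1) := hg hj (show j + 1 < m by omega) (by omega)
      exact hasDerivAt_distToGrid_sq_of_lt (i := j + 1) (by omega) (by omega)
        (abs_sub_lt_abs_sub_of_half_lt h3 (by exact_mod_cast h2))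

lemma abs_distToGrid_update_sq_sub_le {m : ℕ} {j : ℕ} (hj : j < m) (g : ℕ → ℝ) (ξ s t : ℝ) :
    |distToGrid m (Function.update g j s) ξ ^ 2 - distToGrid m (Function.update g j t) ξ ^ 2| ≤
      (|ξ - s| + |ξ - t|) * |s - t| := by
  have hm := Nat.zero_lt_of_lt hj
  have hle : ∀ u, distToGrid m (Function.update g j u) ξ ≤ |ξ - u| := fun u => by
    simpa using distToGrid_le (Function.update g j u) ξ hj
  have h1 := distToGrid_update_le_add hm g ξ j s t
  have h2 := distToGrid_update_le_add hm g ξ j t s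
  rw [abs_sub_comm t s] at h2
  have hs := distToGrid_nonneg m (Function.update g j s) ξ
  have ht := distToGrid_nonneg m (Function.update g j t) ξ
  rw [sq_sub_sq, abs_mul, abs_of_nonneg (add_nonneg hs ht)]
  exact mul_le_mul (add_le_add (hle s) (hle t)) (abs_le.2 ⟨by linarith, by linarith⟩)
    (abs_nonneg _) (by positivity)

/-! ### Truncated moments of the standard normal distribution -/

lemma measurableSet_coe_le (c : EReal) : MeasurableSet {x : ℝ | (x : EReal) ≤ c} :=
  measurableSet_le measurable_coe_real_ereal measurable_const

lemma setIntegral_gaussianReal_one (c : EReal) :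
    ∫ _ in {x : ℝ | (x : EReal) ≤ c}, (1 : ℝ) ∂(gaussianReal 0 1) = Phi0E c := by
  induction c <;> simp [Phi0E, Phi0, Measure.real, Set.Iic]

lemma integrable_id_gaussianReal : Integrable (fun x : ℝ => x) (gaussianReal 0 1) :=
  (memLp_id_gaussianReal' 1 (by simp)).integrable le_rfl

lemma hasDerivAt_gaussianPDFReal (x : ℝ) :
    HasDerivAt (gaussianPDFReal 0 1) (-(gaussianPDFReal 0 1 x * x)) x := by
  have h : HasDerivAt (fun x : ℝ => -(x - 0) ^ 2 / (2 * ((1 : ℝ≥0) : ℝ))) (-x) x := by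
    refine ((((hasDerivAt_id x).sub_const 0).fun_pow 2).fun_neg.div_const
      (2 * ((1 : ℝ≥0) : ℝ))).congr_deriv ?_
    simp [neg_div]
  refine (h.exp.const_mul (√(2 * π * ((1 : ℝ≥0) : ℝ)))⁻¹).congr_deriv ?_
  rw [gaussianPDFReal]; ring

lemma tendsto_gaussianPDFReal_atBot :
    Filter.Tendsto (gaussianPDFReal 0 1) Filter.atBot (𝓝 0) := by
  have h : Filter.Tendsto (fun x : ℝ => -(x - 0) ^ 2 / (2 * ((1 : ℝ≥0) : ℝ)))
      Filter.atBot Filter.atBot := by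
    have h2 : Filter.Tendsto (fun x : ℝ => x ^ 2 / 2) Filter.atBot Filter.atTop :=
      ((Filter.tendsto_pow_atTop two_ne_zero).comp
        Filter.tendsto_abs_atBot_atTop).atTop_div_const two_pos |>.congr fun x => by simp
    refine (Filter.tendsto_neg_atTop_atBot.comp h2).congr fun x => ?_
    simp [neg_div]
  simpa [gaussianPDFReal_def] using
    (Real.tendsto_exp_atBot.comp h).const_mul (√(2 * π * ((1 : ℝ≥0) : ℝ)))⁻¹

lemma setIntegral_gaussianReal_id (c : EReal) :
    ∫ x in {x : ℝ | (x : EReal) ≤ c}, x ∂(gaussianReal 0 1) = -phi0E c := by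
  induction c with
  | bot => simp [phi0E]
  | top => simp [phi0E]
  | coe a =>
    have hint : Integrable (fun x => gaussianPDFReal 0 1 x * x) := by
      have h := integrable_id_gaussianReal
      rw [gaussianReal_of_var_ne_zero 0 one_ne_zero,
        integrable_withDensity_iff_integrable_smul' (measurable_gaussianPDF _ _)
          (ae_of_all _ fun _ => gaussianPDF_lt_top)] at h
      simpa [toReal_gaussianPDF] using h
    have hset : {x : ℝ | (x : EReal) ≤ (a : EReal)} = Set.Iic a := by ext; simp
    have hI := integral_Iic_of_hasDerivAt_of_tendsto'
      (fun x (_ : x ∈ Set.Iic a) => hasDerivAt_gaussianPDFReal x) hint.neg.integrableOn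
      tendsto_gaussianPDFReal_atBot
    rw [sub_zero, integral_neg] at hI
    rw [hset, ← integral_indicator measurableSet_Iic,
      integral_gaussianReal_eq_integral_smul one_ne_zero]
    simp only [phi0E, EReal.coe_ne_bot, EReal.coe_ne_top, or_self, if_false, EReal.toReal_coe]
    rw [← hI, neg_neg, ← integral_indicator measurableSet_Iic]
    congr 1 with x
    by_cases hx : x ∈ Set.Iic a <;> simp [hx]

lemma integrable_sub_mul_gaussianReal (a ϑ : ℝ) :
    Integrable (fun x : ℝ => a - ϑ * x) (gaussianReal 0 1) :=
  (integrable_const a).sub (integrable_id_gaussianReal.const_mul ϑ)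

lemma setIntegral_gaussianReal_affine (c : EReal) (a ϑ : ℝ) :
    ∫ x in {x : ℝ | (x : EReal) ≤ c}, (a - ϑ * x) ∂(gaussianReal 0 1) =
      a * Phi0E c + ϑ * phi0E c := by
  rw [integral_sub (integrable_const a).integrableOn
    (integrable_id_gaussianReal.const_mul ϑ).integrableOn, integral_const_mul,
    setIntegral_gaussianReal_id, ← setIntegral_gaussianReal_one, ← integral_const_mul]
  simp

lemma coe_add_mul_le_iff {c : EReal} {m ϑ x : ℝ} (hϑ : 0 < ϑ) :
    ((m + ϑ * x : ℝ) : EReal) ≤ c ↔ (x : EReal) ≤ affE c m ϑ := by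
  induction c with
  | bot => simp only [affE, hϑ.not_gt]; simp [-EReal.coe_add, -EReal.coe_mul]
  | top => simp [affE, hϑ.not_gt]
  | coe a =>
    simp only [affE, EReal.coe_ne_bot, EReal.coe_ne_top, if_false, EReal.toReal_coe,
      EReal.coe_le_coe_iff]
    rw [le_div_iff₀ hϑ, le_sub_iff_add_le', mul_comm]

lemma ae_coe_add_mul_ne {m ϑ : ℝ} (hϑ : ϑ ≠ 0) (c : EReal) :
    ∀ᵐ x ∂(gaussianReal 0 1), ((m + ϑ * x : ℝ) : EReal) ≠ c := by
  have := nullSingletonClass_gaussianReal (μ := 0) (v := 1) one_ne_zero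
  have h : ∀ᵐ x ∂(gaussianReal 0 1), x ≠ (c.toReal - m) / ϑ := by
    simp [ae_iff]
  filter_upwards [h] with x hx hc
  apply hx
  rw [← hc, EReal.toReal_coe]
  field_simp
  ring

/-- Derivative in one grid point of the mean squared distance of a normal variable to a grid. -/
lemma hasDerivAt_integral_distToGrid_sq {M : ℕ} {g : ℕ → ℝ} (hg : StrictMonoOn g {j | j < M})
    {j : ℕ} (hj : j < M) (m : ℝ) {ϑ : ℝ} (hϑ : 0 < ϑ) :
    HasDerivAt (fun t => ∫ x, distToGrid M (Function.update g j t) (m + ϑ * x) ^ 2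
        ∂(gaussianReal 0 1))
      (2 * ((g j - m) * (Phi0E (affE (hi M g j) m ϑ) - Phi0E (affE (lo g j) m ϑ))
        + ϑ * (phi0E (affE (hi M g j) m ϑ) - phi0E (affE (lo g j) m ϑ)))) (g j) := by
  have hM := Nat.zero_lt_of_lt hj
  set f : ℝ → ℝ := fun x => g j - m - ϑ * x with hf
  set U : Set ℝ := {x : ℝ | (x : EReal) ≤ affE (hi M g j) m ϑ} with hU
  set L : Set ℝ := {x : ℝ | (x : EReal) ≤ affE (lo g j) m ϑ} with hL
  have hfi : Integrable f (gaussianReal 0 1) := integrable_sub_mul_gaussianReal _ _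
  have hUi : Integrable (U.indicator f) (gaussianReal 0 1) :=
    hfi.indicator (measurableSet_coe_le _)
  have hLi : Integrable (L.indicator f) (gaussianReal 0 1) :=
    hfi.indicator (measurableSet_coe_le _)
  have hcont : ∀ t, Continuous fun x =>
      distToGrid M (Function.update g j t) (m + ϑ * x) ^ 2 := fun t =>
    ((continuous_distToGrid hM _).comp (by fun_prop)).pow 2
  have key := hasDerivAt_integral_of_dominated_loc_of_lip (𝕜 := ℝ) (μ := gaussianReal 0 1)
    (F := fun t x => distToGrid M (Function.update g j t) (m + ϑ * x) ^ 2)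
    (F' := fun x => 2 * (U.indicator f x - L.indicator f x))
    (x₀ := g j) (s := Metric.ball (g j) 1) (bound := fun x => 2 * (|f x| + 1))
    (Metric.ball_mem_nhds _ one_pos)
    (Filter.Eventually.of_forall fun t => (hcont t).aestronglyMeasurable) ?_
    ((hUi.sub hLi).const_mul 2).aestronglyMeasurable ?_
    ((hfi.abs.add (integrable_const 1)).const_mul 2) ?_
  · refine key.2.congr_deriv ?_
    rw [integral_const_mul, integral_sub hUi hLi, integral_indicator (measurableSet_coe_le _),
      integral_indicator (measurableSet_coe_le _), setIntegral_gaussianReal_affine,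
      setIntegral_gaussianReal_affine]
    ring
  · have hsq : Integrable (fun x => f x ^ 2) (gaussianReal 0 1) := by
      have h : MemLp f 2 (gaussianReal 0 1) :=
        (memLp_const _).sub ((memLp_id_gaussianReal 2).const_mul ϑ)
      exact h.integrable_sq
    refine hsq.mono (hcont _).aestronglyMeasurable (ae_of_all _ fun x => ?_)
    rw [norm_pow, norm_pow]
    gcongr
    rw [Function.update_eq_self, Real.norm_eq_abs, Real.norm_eq_abs,
      abs_of_nonneg (distToGrid_nonneg _ _ _)]
    refine (distToGrid_le g _ hj).trans_eq ?_
    rw [abs_sub_comm, hf]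
    congr 1; ring
  · refine ae_of_all _ fun x => LipschitzOnWith.of_dist_le_mul fun s hs t ht => ?_
    rw [Real.dist_eq, Real.dist_eq, Real.coe_nnabs,
      abs_of_nonneg (show 0 ≤ 2 * (|f x| + 1) by positivity)]
    refine (abs_distToGrid_update_sq_sub_le hj g (m + ϑ * x) s t).trans ?_
    have hb : ∀ u ∈ Metric.ball (g j) 1, |m + ϑ * x - u| ≤ |f x| + 1 := fun u hu => by
      rw [Metric.mem_ball, Real.dist_eq, abs_sub_comm] at hu
      have e : m + ϑ * x - u = -(f x) + (g j - u) := by rw [hf]; ring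
      rw [e]
      refine (abs_add_le _ _).trans ?_
      rw [abs_neg]
      linarith
    gcongr
    linarith [hb s hs, hb t ht]
  · filter_upwards [ae_coe_add_mul_ne hϑ.ne' (lo g j), ae_coe_add_mul_ne hϑ.ne' (hi M g j)]
      with x h1 h2
    refine (hasDerivAt_distToGrid_sq hg hj h1 h2).congr_deriv ?_
    simp only [coe_add_mul_le_iff hϑ, Set.indicator_apply, hU, hL, Set.mem_ofPred_eq, hf,
      sub_sub]

/-! ### Linear images of the standard Gaussian vector -/

lemma map_sum_mul_gaussPi {q : ℕ} (a : Fin q → ℝ) :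
    (gaussPi q).map (fun z => ∑ p, a p * z p) =
      (gaussianReal 0 1).map (fun x => √(∑ p, a p ^ 2) * x) := by
  have hL : (fun z : Fin q → ℝ => ∑ p, a p * z p) =
      (innerSL ℝ (WithLp.toLp 2 a : EuclideanSpace ℝ (Fin q))) ∘ WithLp.toLp 2 := by
    ext z
    simp [PiLp.inner_apply, mul_comm]
  rw [hL, ← Measure.map_map (by fun_prop) (by fun_prop), gaussPi, map_pi_eq_stdGaussian,
    IsGaussian.map_eq_gaussianReal, integral_strongDual_stdGaussian, variance_dual_stdGaussian,
    gaussianReal_map_const_mul, mul_zero]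
  congr 1
  ext
  simp [EuclideanSpace.norm_eq, innerSL_apply_norm]

lemma integral_gaussPi_comp {q : ℕ} {f : ℝ → ℝ} (hf : Continuous f) (m c : ℝ)
    (a : Fin q → ℝ) :
    ∫ z, f (m + c * ∑ p, a p * z p) ∂(gaussPi q) =
      ∫ x, f (m + c * √(∑ p, a p ^ 2) * x) ∂(gaussianReal 0 1) := by
  have h : Continuous fun y => f (m + c * y) := by fun_prop
  have h1 := integral_map (μ := gaussPi q) (φ := fun z : Fin q → ℝ => ∑ p, a p * z p)
    (f := fun y => f (m + c * y))
    (by fun_prop : Continuous fun z : Fin q → ℝ => ∑ p, a p * z p).measurable.aemeasurable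
    h.aestronglyMeasurable
  have h2 := integral_map (μ := gaussianReal 0 1) (φ := fun x => √(∑ p, a p ^ 2) * x)
    (f := fun y => f (m + c * y)) (by fun_prop) h.aestronglyMeasurable
  rw [← h1, map_sum_mul_gaussPi, h2]
  simp only [mul_assoc]

/-- Gradient of the distortion: the partial derivative of
`Γ ↦ ∑_{i∈I_k} E[dist(E_k^ℓ(x_k^i,Z),Γ)²] P(X̂_k = x_k^i)` with respect to the `j_ℓ`-th
grid point equals `2 ∑_{i∈I_k} Ψ'_{j_ℓ}(x_k^i) P(X̂_k = x_k^i) = 2 E[Ψ'_{j_ℓ}(X̂_k)]`. -/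
theorem statement_7
    {Ω : Type*} [MeasureSpace Ω] [IsProbabilityMeasure (ℙ : Measure Ω)]
    (d q n : ℕ) (hd : 0 < d) (hq : 0 < q) (hn : 0 < n)
    (T Δ : ℝ) (hT : 0 < T) (hΔ : Δ = T / n)
    (b : ℕ → (Fin d → ℝ) → Fin d → ℝ)
    (σm : ℕ → (Fin d → ℝ) → Fin d → Fin q → ℝ)
    (N : ℕ → Fin d → ℕ) (hN : ∀ k ℓ, 0 < N k ℓ)
    (grid : ℕ → Fin d → ℕ → ℝ)
    (hgrid : ∀ k ℓ, StrictMonoOn (grid k ℓ) {j | j < N k ℓ})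
    (Z : ℕ → Ω → Fin q → ℝ) (hZmeas : ∀ k, Measurable (Z k))
    (hZlaw : ∀ k, Measure.map (Z (k + 1)) ℙ = gaussPi q)
    (Xtil Xhat : ℕ → Ω → Fin d → ℝ)
    (hXtilmeas : ∀ k, Measurable (Xtil k)) (hXhatmeas : ∀ k, Measurable (Xhat k))
    (hindep : ∀ k, IndepFun (Xhat k) (Z (k + 1)) ℙ)
    (hX0 : Xtil 0 = Xhat 0)
    (hrec : ∀ k ω ℓ, Xtil (k + 1) ω ℓ =
      Xhat k ω ℓ + Δ * b k (Xhat k ω) ℓ +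
        Real.sqrt Δ * ∑ p, σm k (Xhat k ω) ℓ p * Z (k + 1) ω p)
    (hproj : ∀ k ω ℓ j, j < N k ℓ →
      Xtil k ω ℓ ∈ cell (N k ℓ) (grid k ℓ) j → Xhat k ω ℓ = grid k ℓ j)
    (hran : ∀ k ω ℓ, ∃ j, j < N k ℓ ∧ Xhat k ω ℓ = grid k ℓ j)
    -- data of the statement
    (k : ℕ) (hk : k < n) (ℓ : Fin d)
    (xk : ((ℓ' : Fin d) → Fin (N k ℓ')) → Fin d → ℝ)
    (hxk : ∀ i, xk i = fun ℓ' => grid k ℓ' (i ℓ' : ℕ))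
    (mfun : ((ℓ' : Fin d) → Fin (N k ℓ')) → ℝ)
    (hmfun : ∀ i, mfun i = xk i ℓ + Δ * b k (xk i) ℓ)
    (ϑ : ((ℓ' : Fin d) → Fin (N k ℓ')) → ℝ)
    (hϑ : ∀ i, ϑ i = Real.sqrt Δ * Real.sqrt (∑ p, (σm k (xk i) ℓ p) ^ 2))
    (hϑpos : ∀ i, 0 < ϑ i)
    -- the distortion as a function of the grid
    (Dfun : (ℕ → ℝ) → ℝ)
    (hDfun : ∀ g, Dfun g = ∑ i : (ℓ' : Fin d) → Fin (N k ℓ'),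
      (∫ z : Fin q → ℝ,
        (distToGrid (N (k + 1) ℓ) g
          (xk i ℓ + Δ * b k (xk i) ℓ +
            Real.sqrt Δ * ∑ p, σm k (xk i) ℓ p * z p)) ^ 2 ∂(gaussPi q))
      * pr {ω | Xhat k ω = xk i})
    (Psi' : ((ℓ' : Fin d) → Fin (N k ℓ')) → ℕ → ℝ)
    (hPsi' : ∀ i j, Psi' i j =
      (grid (k + 1) ℓ j - mfun i)
        * (Phi0E (affE (hi (N (k + 1) ℓ) (grid (k + 1) ℓ) j) (mfun i) (ϑ i))
            - Phi0E (affE (lo (grid (k + 1) ℓ) j) (mfun i) (ϑ i)))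
      + ϑ i * (phi0E (affE (hi (N (k + 1) ℓ) (grid (k + 1) ℓ) j) (mfun i) (ϑ i))
            - phi0E (affE (lo (grid (k + 1) ℓ) j) (mfun i) (ϑ i)))) :
    ∀ j, j < N (k + 1) ℓ →
      HasDerivAt (fun t => Dfun (Function.update (grid (k + 1) ℓ) j t))
        (2 * ∑ i : (ℓ' : Fin d) → Fin (N k ℓ'),
          Psi' i j * pr {ω | Xhat k ω = xk i})
        (grid (k + 1) ℓ j) := by
  intro j hj
  have hM := Nat.zero_lt_of_lt hj
  have hint : ∀ g, Dfun g = ∑ i, (∫ x, distToGrid (N (k + 1) ℓ) g (mfun i + ϑ i * x) ^ 2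
      ∂(gaussianReal 0 1)) * pr {ω | Xhat k ω = xk i} := fun g => by
    simp only [hDfun, hmfun, hϑ, integral_gaussPi_comp
      (f := fun y => distToGrid (N (k + 1) ℓ) g y ^ 2) ((continuous_distToGrid hM g).pow 2)]
  simp only [hint, Finset.mul_sum, ← mul_assoc]
  refine HasDerivAt.fun_sum fun i _ => HasDerivAt.mul_const (𝕜 := ℝ) ?_ _
  rw [hPsi']
  exact hasDerivAt_integral_distToGrid_sq (hgrid (k + 1) ℓ) hj (mfun i) (hϑpos i)
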